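/- Let d ≥ 1, N ≥ 1, let ψ : Fin d → ℂ be a unit vector, let Q_{ψ*}(j,k) = conj(ψ j)·(ψ k), and let R_N be the N-fold tensor power of the maximally entangled qudit density matrix, R_N((a,b),(a',b')) = ∏_i Φ_d((a i, b i),(a' i, b' i)) with Φ_d((x,y),(x',y')) = (1/d)·[x = y]·[x' = y']. For x ∈ Fin N, let M_x be the matrix on (Fin N → Fin d) with entries M_x(a,a') = ∑_{S ⊆ Fin N, x ∈ S} (1/|S|)·∏_{i ∈ S} Q_{ψ*}(a i)(a' i)·∏_{i ∉ S} (I - Q_{ψ*})(a i)(a' i). Then for every x ∈ Fin N and all j, k ∈ Fin d, the partial trace of (M_x ⊗ I)·R_N over Alice's system and all of Bob's registers except the x-th, namely ∑_{a : Fin N → Fin d} ∑_{b, b' : Fin N → Fin d with b x = j, b' x = k, and b i = b' i for all i ≠ x} ((M_x ⊗ I)·R_N)((a,b),(a,b')), equals ((1 - (1-1/d)^N)/N)·(ψ j)·conj(ψ k). (Hence conditioned on outcome x, Bob's port B_x holds exactly |ψ⟩⟨ψ|, and each outcome x occurs with probability (1-(1-1/d)^N)/N; this is the content of Theorem 3.1.)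 -/

import Mathlib

open Kronecker Matrix

/-- The density matrix of the maximally entangled state
`|φ⁺_d⟩ = (1/√d) ∑_x |x⟩⊗|x⟩`. -/
noncomputable def maxEnt (d : ℕ) : Matrix (Fin d × Fin d) (Fin d × Fin d) ℂ :=
  Matrix.of fun p q => if p.1 = p.2 ∧ q.1 = q.2 then (1 / d : ℂ) else 0

/-- The resource of `N` independent maximally entangled qudit pairs, with
Alice's registers grouped first. -/
noncomputable def resource (d N : ℕ) :
    Matrix ((Fin N → Fin d) × (Fin N → Fin d))
      ((Fin N → Fin d) × (Fin N → Fin d)) ℂ :=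
  Matrix.of fun p q => ∏ i : Fin N, maxEnt d (p.1 i, p.2 i) (q.1 i, q.2 i)

/-- The projector `|ψ*⟩⟨ψ*|` onto the conjugate state. -/
noncomputable def projConj (d : ℕ) (ψ : Fin d → ℂ) : Matrix (Fin d) (Fin d) ℂ :=
  Matrix.of fun a b => star (ψ a) * ψ b

/-- Alice's PBSP measurement operator for outcome `x`:
`M_x = ∑_{S ∋ x} (1/|S|) ⊗_{i∈S} |ψ*⟩⟨ψ*| ⊗ ⊗_{i∉S} (I - |ψ*⟩⟨ψ*|)`. -/
noncomputable def pbspPOVM (d N : ℕ) (ψ : Fin d → ℂ) (x : Fin N) :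
    Matrix (Fin N → Fin d) (Fin N → Fin d) ℂ :=
  Matrix.of fun a a' =>
    ∑ S ∈ Finset.univ.filter (fun S : Finset (Fin N) => x ∈ S),
      (1 / (S.card : ℂ)) *
        ((∏ i ∈ S, projConj d ψ (a i) (a' i)) *
          ∏ i ∈ Sᶜ, ((1 : Matrix (Fin d) (Fin d) ℂ) - projConj d ψ) (a i) (a' i))

/-- Entrywise, the resource is `d⁻ᴺ` times an indicator that both indices are diagonal. -/
lemma resource_apply (d N : ℕ) (a b a' b' : Fin N → Fin d) :
    resource d N (a, b) (a', b') = if a = b ∧ a' = b' then (1 / d : ℂ) ^ N else 0 := by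
  simp only [resource, maxEnt, Matrix.of_apply]
  split_ifs with h
  · simp [h.1, h.2]
  · have : ∃ i, ¬ (a i = b i ∧ a' i = b' i) := by
      by_contra! hc
      exact h ⟨funext fun i => (hc i).1, funext fun i => (hc i).2⟩
    obtain ⟨i, hi⟩ := this
    exact Finset.prod_eq_zero (Finset.mem_univ i) (if_neg hi)

/-- The resource transfers an operator on Alice's side to Bob's. -/
lemma kronecker_one_mul_resource_apply (d N : ℕ)
    (M : Matrix (Fin N → Fin d) (Fin N → Fin d) ℂ) (a b b' : Fin N → Fin d) :
    ((M ⊗ₖ (1 : Matrix (Fin N → Fin d) (Fin N → Fin d) ℂ)) * resource d N) (a, b) (a, b')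
      = if a = b' then (1 / d : ℂ) ^ N * M a b else 0 := by
  rw [Matrix.mul_apply, Fintype.sum_prod_type, Finset.sum_eq_single b, Finset.sum_eq_single b]
  · simp [resource_apply, Matrix.kroneckerMap_apply, mul_comm]
  · intro c _ hc
    simp [Matrix.kroneckerMap_apply, Matrix.one_apply_ne' hc]
  · simp
  · intro c _ hc
    refine Finset.sum_eq_zero fun e _ => ?_
    by_cases he : b = e
    · subst he
      simp [resource_apply, hc]
    · simp [Matrix.kroneckerMap_apply, Matrix.one_apply_ne he]
  · simp

/-- The partial trace of a tensor product over all factors but `x`. -/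
lemma sum_sum_ite_prod {κ R : Type*} [Fintype κ] [DecidableEq κ] [CommSemiring R] {N : ℕ}
    (F : Fin N → Matrix κ κ R) (x : Fin N) (j k : κ) :
    ∑ b : Fin N → κ, ∑ b' : Fin N → κ,
      (if b x = j ∧ b' x = k ∧ ∀ i : Fin N, i ≠ x → b i = b' i then ∏ i, F i (b' i) (b i) else 0)
      = F x k j * ∏ i ∈ Finset.univ.erase x, (F i).trace := by
  have hprod : ∀ b b' : Fin N → κ,
      (if b x = j ∧ b' x = k ∧ ∀ i : Fin N, i ≠ x → b i = b' i then ∏ i, F i (b' i) (b i) else 0)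
        = ∏ i, if (if i = x then b i = j ∧ b' i = k else b i = b' i)
            then F i (b' i) (b i) else 0 := by
    intro b b'
    split_ifs with h
    · refine Finset.prod_congr rfl fun i _ => (if_pos ?_).symm
      split_ifs with hi
      · exact hi ▸ ⟨h.1, h.2.1⟩
      · exact h.2.2 i hi
    · have : ∃ i, ¬ (if i = x then b i = j ∧ b' i = k else b i = b' i) := by
        by_contra! hc
        have hx := hc x
        rw [if_pos rfl] at hx
        refine h ⟨hx.1, hx.2, fun i hi => ?_⟩
        simpa [hi] using hc i
      obtain ⟨i, hi⟩ := this
      exact (Finset.prod_eq_zero (Finset.mem_univ i) (if_neg hi)).symm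
  have hsum : ∀ f : Fin N → κ → κ → R,
      ∑ b : Fin N → κ, ∑ b' : Fin N → κ, ∏ i, f i (b i) (b' i) = ∏ i, ∑ u, ∑ v, f i u v := by
    intro f
    rw [Fintype.prod_sum]
    exact Finset.sum_congr rfl fun b _ => (Fintype.prod_sum fun i v => f i (b i) v).symm
  simp_rw [hprod]
  rw [hsum fun i u v => if (if i = x then u = j ∧ v = k else u = v) then F i v u else 0,
    ← Finset.mul_prod_erase _ _ (Finset.mem_univ x)]
  congr 1
  · simp [ite_and]
  · refine Finset.prod_congr rfl fun i hi => ?_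
    simp [Finset.ne_of_mem_erase hi, Matrix.trace]

/-- Averaging a function of the cardinality over the members of each nonempty set. -/
lemma card_mul_sum_filter_mem {ι K : Type*} [Fintype ι] [DecidableEq ι] [Field K] [CharZero K]
    (f : ℕ → K) (x : ι) :
    (Fintype.card ι : K) * ∑ S : Finset ι with x ∈ S, 1 / (S.card : K) * f S.card
      = (∑ S : Finset ι, f S.card) - f 0 := by
  have hsymm : ∀ y : ι, ∑ S : Finset ι with y ∈ S, 1 / (S.card : K) * f S.card
      = ∑ S : Finset ι with x ∈ S, 1 / (S.card : K) * f S.card := by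
    intro y
    simp only [Finset.sum_filter]
    rw [← Equiv.sum_comp (Equiv.swap x y).finsetCongr]
    refine Finset.sum_congr rfl fun S _ => ?_
    simp [Finset.mem_map_equiv]
  have hcount : ∑ y : ι, ∑ S : Finset ι with y ∈ S, 1 / (S.card : K) * f S.card
      = (∑ S : Finset ι, f S.card) - f 0 := by
    simp only [Finset.sum_filter]
    rw [Finset.sum_comm, ← Finset.add_sum_erase _ _ (Finset.mem_univ (∅ : Finset ι)),
      ← Finset.add_sum_erase _ (fun S : Finset ι => f S.card) (Finset.mem_univ ∅)]
    simp only [Finset.notMem_empty, if_false, Finset.sum_const_zero, zero_add,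
      Finset.card_empty, add_sub_cancel_left]
    refine Finset.sum_congr rfl fun S hS => ?_
    have hcard : (S.card : K) ≠ 0 := by
      simpa using Finset.ne_of_mem_erase hS
    rw [← Finset.sum_filter, Finset.sum_const, Finset.filter_univ_mem, nsmul_eq_mul]
    field_simp
  rw [← hcount, Finset.sum_congr rfl fun y _ => hsymm y, Finset.sum_const, nsmul_eq_mul,
    Finset.card_univ]

/-- The weighted sum governing the outcome probabilities. -/
lemma card_mul_sum_filter_mem_pow {ι K : Type*} [Fintype ι] [DecidableEq ι] [Field K]
    [CharZero K] (p : K) (x : ι) :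
    (Fintype.card ι : K) * ∑ S : Finset ι with x ∈ S, 1 / (S.card : K) * p ^ Sᶜ.card
      = (1 + p) ^ Fintype.card ι - p ^ Fintype.card ι := by
  simp only [Finset.card_compl]
  rw [card_mul_sum_filter_mem (fun m => p ^ (Fintype.card ι - m)) x,
    ← Fintype.sum_pow_mul_eq_add_pow]
  simp

/-- Conditioned on Alice's PBSP outcome `x`, Bob's port `B_x` holds exactly
`|ψ⟩⟨ψ|`, and each outcome `x ∈ [N]` occurs with probability
`(1 - (1-1/d)^N)/N`: the partial trace of `(M_x ⊗ I)·R_N` over Alice's system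
and all of Bob's registers except the `x`-th equals
`((1 - (1-1/d)^N)/N)·(ψ j)·conj(ψ k)`. -/
theorem pbsp_port_state (d N : ℕ) (hd : 1 ≤ d) (hN : 1 ≤ N)
    (ψ : Fin d → ℂ) (hψ : ∑ j : Fin d, star (ψ j) * ψ j = 1)
    (x : Fin N) (j k : Fin d) :
    ∑ a : Fin N → Fin d, ∑ b : Fin N → Fin d, ∑ b' : Fin N → Fin d,
        (if b x = j ∧ b' x = k ∧ ∀ i : Fin N, i ≠ x → b i = b' i then
          ((pbspPOVM d N ψ x ⊗ₖ
              (1 : Matrix (Fin N → Fin d) (Fin N → Fin d) ℂ)) *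
            resource d N) (a, b) (a, b')
        else 0)
    = (1 - (1 - 1 / d : ℂ) ^ N) / N * (ψ j * star (ψ k)) := by
  have htrace : (projConj d ψ).trace = 1 := by
    simpa [Matrix.trace, projConj] using hψ
  have htrace' : (1 - projConj d ψ).trace = (d : ℂ) - 1 := by
    simp [Matrix.trace_sub, htrace]
  have hd' : (d : ℂ) ≠ 0 := Nat.cast_ne_zero.mpr (by lia)
  have hN' : (N : ℂ) ≠ 0 := Nat.cast_ne_zero.mpr (by lia)
  let F (S : Finset (Fin N)) (i : Fin N) : Matrix (Fin d) (Fin d) ℂ :=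
    if i ∈ S then projConj d ψ else 1 - projConj d ψ
  have hPOVM : ∀ a a', pbspPOVM d N ψ x a a' =
      ∑ S : Finset (Fin N) with x ∈ S, 1 / (S.card : ℂ) * ∏ i, F S i (a i) (a' i) := by
    intro a a'
    simp only [pbspPOVM, Matrix.of_apply]
    refine Finset.sum_congr rfl fun S _ => ?_
    rw [← Finset.prod_mul_prod_compl S fun i => F S i (a i) (a' i)]
    congr 2
    · exact Finset.prod_congr rfl fun i hi => by simp [F, hi]
    · exact Finset.prod_congr rfl fun i hi => by simp [F, Finset.mem_compl.mp hi]
  have hF : ∀ S : Finset (Fin N), x ∈ S →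
      ∏ i ∈ Finset.univ.erase x, (F S i).trace = ((d : ℂ) - 1) ^ Sᶜ.card := by
    intro S hS
    have hx : (F S x).trace = 1 := by simp [F, hS, htrace]
    rw [Finset.prod_erase (f := fun i => (F S i).trace) _ hx, ← Finset.prod_mul_prod_compl S,
      Finset.prod_eq_one fun i hi => by simp [F, hi, htrace], one_mul]
    exact Finset.prod_eq_pow_card fun i hi => by simp [F, Finset.mem_compl.mp hi, htrace']
  have hsum := card_mul_sum_filter_mem_pow ((d : ℂ) - 1) x
  rw [Fintype.card_fin, add_sub_cancel] at hsum
  calc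
    _ = ∑ b : Fin N → Fin d, ∑ b' : Fin N → Fin d,
        if b x = j ∧ b' x = k ∧ ∀ i : Fin N, i ≠ x → b i = b' i then
          (1 / d : ℂ) ^ N * pbspPOVM d N ψ x b' b else 0 := by
      rw [Finset.sum_comm]
      refine Finset.sum_congr rfl fun b _ => ?_
      rw [Finset.sum_comm]
      refine Finset.sum_congr rfl fun b' _ => ?_
      simp only [kronecker_one_mul_resource_apply]
      split_ifs <;> simp
    _ = (1 / d : ℂ) ^ N * ∑ S : Finset (Fin N) with x ∈ S, 1 / (S.card : ℂ) *
        ∑ b : Fin N → Fin d, ∑ b' : Fin N → Fin d,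
          if b x = j ∧ b' x = k ∧ ∀ i : Fin N, i ≠ x → b i = b' i then
            ∏ i, F S i (b' i) (b i) else 0 := by
      simp only [hPOVM, Finset.mul_sum]
      conv_rhs => rw [Finset.sum_comm]
      refine Finset.sum_congr rfl fun b _ => ?_
      rw [Finset.sum_comm]
      refine Finset.sum_congr rfl fun b' _ => ?_
      split_ifs <;> simp
    _ = (1 / d : ℂ) ^ N * ((∑ S : Finset (Fin N) with x ∈ S,
        1 / (S.card : ℂ) * ((d : ℂ) - 1) ^ Sᶜ.card) * (ψ j * star (ψ k))) := by
      rw [Finset.sum_mul]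
      congr 1
      refine Finset.sum_congr rfl fun S hS => ?_
      have hxS : x ∈ S := (Finset.mem_filter.mp hS).2
      rw [sum_sum_ite_prod (F S) x j k, hF S hxS]
      simp only [F, if_pos hxS, projConj, Matrix.of_apply]
      ring
    _ = _ := by
      rw [eq_div_of_mul_eq hN' ((mul_comm _ _).trans hsum), one_sub_div hd', div_pow, div_pow,
        one_pow]
      field_simp
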